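/- Let θ_g = (1+√5)/2, let a, b > 0 with a/b = θ_g, and let α ∈ ℝ. If α > π²/(√5·a), then the gap set G₊(α) has infinitely many connected components; if α ≤ −π²/(√5·a), then the gap set G₋(α) has infinitely many connected components. -/

import Mathlib

open Real

/-- The gap condition set for a rectangular-lattice quantum graph with edge lengths
`a, b` and coupling `α > 0`. -/
def gapSetPlus (a b α : ℝ) : Set ℝ :=
  {k : ℝ | 0 < k ∧ (∀ n : ℤ, k * a / π ≠ n) ∧ (∀ n : ℤ, k * b / π ≠ n) ∧
    2 * k * (Real.tan (k * a / 2 - π / 2 * ⌊k * a / π⌋)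
      + Real.tan (k * b / 2 - π / 2 * ⌊k * b / π⌋)) < α}

/-- The gap condition set for a rectangular-lattice quantum graph with edge lengths
`a, b` and coupling `α < 0`. -/
def gapSetMinus (a b α : ℝ) : Set ℝ :=
  {k : ℝ | 0 < k ∧ (∀ n : ℤ, k * a / π ≠ n) ∧ (∀ n : ℤ, k * b / π ≠ n) ∧
    2 * k * (Real.cot (k * a / 2 - π / 2 * ⌊k * a / π⌋)
      + Real.cot (k * b / 2 - π / 2 * ⌊k * b / π⌋)) < |α|}

/-- The collection of connected components of a set `G ⊆ ℝ`; open spectral gaps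
correspond to its elements. -/
def gapComponents (G : Set ℝ) : Set (Set ℝ) :=
  {C : Set ℝ | ∃ k ∈ G, C = connectedComponentIn G k}

lemma infinite_gapComponents_of_unbounded {a : ℝ} (ha : 0 < a) {G : Set ℝ}
    (hG : ∀ k ∈ G, ∀ n : ℤ, k * a / π ≠ n) (hunb : ∀ M : ℝ, ∃ k ∈ G, M < k) :
    (gapComponents G).Infinite := by
  intro hfin
  have hbdd : ∀ C ∈ gapComponents G, BddAbove C := by
    rintro C ⟨k, hk, rfl⟩
    refine ⟨(⌊k * a / π⌋ + 1 : ℤ) * π / a, fun x hx => ?_⟩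
    by_contra! hlt
    have hmem : (⌊k * a / π⌋ + 1 : ℤ) * π / a ∈ connectedComponentIn G k := by
      refine isPreconnected_connectedComponentIn.ordConnected.out
        (mem_connectedComponentIn hk) hx ⟨?_, hlt.le⟩
      rw [le_div_iff₀ ha, ← div_le_iff₀ pi_pos]
      push_cast
      exact (Int.lt_floor_add_one _).le
    refine hG _ (connectedComponentIn_subset G k hmem) (⌊k * a / π⌋ + 1) ?_
    field_simp
  obtain ⟨M, hM⟩ := (Set.Finite.bddAbove_biUnion (S := fun C : Set ℝ => C) hfin).2 hbdd
  obtain ⟨k, hk, hlt⟩ := hunb M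
  exact hlt.not_ge (hM (Set.mem_biUnion ⟨k, hk, rfl⟩ (mem_connectedComponentIn hk)))

lemma tan_half_pi_mul_lt {δ : ℝ} (h0 : 0 < δ) (h1 : δ ≤ 1 / 3) :
    tan (π / 2 * δ) * (1 - δ ^ 2) < π / 2 * δ := by
  have hpi := pi_lt_d2
  have hpi3 := pi_gt_three
  set y := π / 2 * δ with hy
  have hy0 : 0 < y := by positivity
  have hy1 : y ≤ 0.53 := by nlinarith
  have hδ : 0.4 * y ^ 2 ≤ δ ^ 2 := by
    rw [hy]
    have : π ^ 2 ≤ 10 := by nlinarith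
    nlinarith [sq_nonneg δ]
  have hcos : 1 - y ^ 2 / 2 ≤ cos y := one_sub_sq_div_two_le_cos
  have hcos0 : 0 < cos y := by nlinarith
  have hsin : sin y ≤ y - y ^ 3 / 6 + y ^ 5 / 100 := by
    have h := (abs_le.1 (sin_bound (x := y) (by rw [abs_of_pos hy0]; linarith))).2
    rw [abs_of_pos hy0] at h
    linarith
  have hsin0 : 0 ≤ sin y := sin_nonneg_of_nonneg_of_le_pi hy0.le (by linarith)
  rw [tan_eq_sin_div_cos, div_mul_eq_mul_div, div_lt_iff₀ hcos0]
  calc sin y * (1 - δ ^ 2) ≤ sin y * (1 - 0.4 * y ^ 2) := by gcongr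
    _ ≤ (y - y ^ 3 / 6 + y ^ 5 / 100) * (1 - 0.4 * y ^ 2) := by
        gcongr; nlinarith
    _ < y * (1 - y ^ 2 / 2) := by
        have : 0 < y ^ 3 * (1 / 15 - y ^ 2 / 15 - y ^ 2 / 100 + y ^ 4 / 250) := by
          apply mul_pos (by positivity)
          have : 0 < y ^ 3 := by positivity
          nlinarith
        linarith
    _ ≤ y * cos y := by gcongr

lemma exists_mem_gapSetPlus {a b α k₀ : ℝ} {p q : ℤ} (ha : 0 < a) (hb : 0 < b)
    (hk₀ : 0 < k₀) (hp : p ≤ k₀ * a / π) (hp' : k₀ * a / π < p + 1)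
    (hq : q ≤ k₀ * b / π) (hq' : k₀ * b / π < q + 1)
    (h : 2 * k₀ * (tan (k₀ * a / 2 - π / 2 * p) + tan (k₀ * b / 2 - π / 2 * q)) < α) :
    ∃ k ∈ gapSetPlus a b α, k₀ < k := by
  have key : ∀ c : ℝ, ∀ n : ℤ, 0 < c → n ≤ k₀ * c / π → k₀ * c / π < n + 1 →
      ContinuousAt (fun k => tan (k * c / 2 - π / 2 * n)) k₀ ∧
      ∀ᶠ k in nhdsWithin k₀ (Set.Ioi k₀), n < k * c / π ∧ k * c / π < n + 1 := by
    intro c n hc h1 h2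
    constructor
    · refine ContinuousAt.comp (g := tan) (f := fun k => k * c / 2 - π / 2 * n) ?_ (by fun_prop)
      rw [continuousAt_tan]
      rw [le_div_iff₀ pi_pos] at h1
      rw [div_lt_iff₀ pi_pos] at h2
      refine (cos_pos_of_mem_Ioo ⟨?_, ?_⟩).ne' <;> linarith [pi_pos]
    · have hcont : ContinuousAt (fun k => k * c / π) k₀ := by fun_prop
      filter_upwards [self_mem_nhdsWithin,
        (hcont.eventually_lt continuousAt_const h2).filter_mono nhdsWithin_le_nhds] with k hk hlt
      refine ⟨h1.trans_lt ?_, hlt⟩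
      have : k₀ < k := hk
      gcongr
  obtain ⟨ca, ea⟩ := key a p ha hp hp'
  obtain ⟨cb, eb⟩ := key b q hb hq hq'
  have hcont : ContinuousAt (fun k => 2 * k *
      (tan (k * a / 2 - π / 2 * p) + tan (k * b / 2 - π / 2 * q))) k₀ :=
    (by fun_prop : ContinuousAt (fun k : ℝ => 2 * k) k₀).mul (ca.add cb)
  obtain ⟨k, hk, ⟨hka, hka'⟩, ⟨hkb, hkb'⟩, hlt⟩ := (Filter.Eventually.and
    (self_mem_nhdsWithin : Set.Ioi k₀ ∈ nhdsWithin k₀ (Set.Ioi k₀))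
    (ea.and (eb.and ((hcont.eventually_lt continuousAt_const h).filter_mono
      nhdsWithin_le_nhds)))).exists
  have hkk : k₀ < k := hk
  have hfa : ⌊k * a / π⌋ = p := Int.floor_eq_iff.2 ⟨hka.le, hka'⟩
  have hfb : ⌊k * b / π⌋ = q := Int.floor_eq_iff.2 ⟨hkb.le, hkb'⟩
  refine ⟨k, ⟨hk₀.trans hkk, ?_, ?_, by rwa [hfa, hfb]⟩, hkk⟩
  · rintro n hn
    rw [hn] at hka hfa
    rw [Int.floor_intCast] at hfa
    simp [hfa] at hka
  · rintro n hn
    rw [hn] at hkb hfb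
    rw [Int.floor_intCast] at hfb
    simp [hfb] at hkb

lemma cot_pi_div_two_sub (x : ℝ) : cot (π / 2 - x) = tan x := by
  rw [Real.cot_eq_cos_div_sin, cos_pi_div_two_sub, sin_pi_div_two_sub, tan_eq_sin_div_cos]

lemma exists_mem_gapSetMinus {a b α k₀ : ℝ} {p q : ℤ} (ha : 0 < a) (hb : 0 < b)
    (hk₀ : 0 < k₀) (hp : p < k₀ * a / π) (hp' : k₀ * a / π ≤ p + 1)
    (hq : q < k₀ * b / π) (hq' : k₀ * b / π ≤ q + 1)
    (h : 2 * k₀ * (cot (k₀ * a / 2 - π / 2 * p) + cot (k₀ * b / 2 - π / 2 * q)) < |α|) :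
    ∃ k ∈ gapSetMinus a b α, k₀ - 1 < k := by
  have key : ∀ c : ℝ, ∀ n : ℤ, 0 < c → n < k₀ * c / π → k₀ * c / π ≤ n + 1 →
      ContinuousAt (fun k => cot (k * c / 2 - π / 2 * n)) k₀ ∧
      ∀ᶠ k in nhdsWithin k₀ (Set.Iio k₀), n < k * c / π ∧ k * c / π < n + 1 := by
    intro c n hc h1 h2
    constructor
    · simp only [Real.cot_eq_cos_div_sin]
      refine ContinuousAt.div (by fun_prop) (by fun_prop) ?_
      rw [lt_div_iff₀ pi_pos] at h1
      rw [div_le_iff₀ pi_pos] at h2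
      refine (sin_pos_of_pos_of_lt_pi ?_ ?_).ne' <;> linarith [pi_pos]
    · have hcont : ContinuousAt (fun k => k * c / π) k₀ := by fun_prop
      filter_upwards [self_mem_nhdsWithin,
        (continuousAt_const.eventually_lt hcont h1).filter_mono nhdsWithin_le_nhds] with k hk hlt
      refine ⟨hlt, lt_of_lt_of_le ?_ h2⟩
      have : k < k₀ := hk
      gcongr
  obtain ⟨ca, ea⟩ := key a p ha hp hp'
  obtain ⟨cb, eb⟩ := key b q hb hq hq'
  have hcont : ContinuousAt (fun k => 2 * k *
      (cot (k * a / 2 - π / 2 * p) + cot (k * b / 2 - π / 2 * q))) k₀ :=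
    (by fun_prop : ContinuousAt (fun k : ℝ => 2 * k) k₀).mul (ca.add cb)
  have hnear : ∀ᶠ k in nhds k₀, max 0 (k₀ - 1) < k :=
    lt_mem_nhds (max_lt hk₀ (by linarith))
  obtain ⟨k, hk, ⟨hka, hka'⟩, ⟨hkb, hkb'⟩, hlt⟩ := (Filter.Eventually.and
    (hnear.filter_mono nhdsWithin_le_nhds)
    (ea.and (eb.and ((hcont.eventually_lt continuousAt_const h).filter_mono
      (nhdsWithin_le_nhds (s := Set.Iio k₀)))))).exists
  have hfa : ⌊k * a / π⌋ = p := Int.floor_eq_iff.2 ⟨hka.le, hka'⟩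
  have hfb : ⌊k * b / π⌋ = q := Int.floor_eq_iff.2 ⟨hkb.le, hkb'⟩
  rw [max_lt_iff] at hk
  refine ⟨k, ⟨hk.1, ?_, ?_, by rwa [hfa, hfb]⟩, hk.2⟩
  · rintro n hn
    rw [hn] at hka hfa
    rw [Int.floor_intCast] at hfa
    simp [hfa] at hka
  · rintro n hn
    rw [hn] at hkb hfb
    rw [Int.floor_intCast] at hfb
    simp [hfb] at hkb

lemma fib_succ_div_goldenRatio (n : ℕ) :
    (Nat.fib (n + 1) : ℝ) / goldenRatio = Nat.fib n - goldenConj ^ (n + 1) := by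
  rw [← goldenConj_mul_fib_succ_add_fib, div_eq_mul_inv, inv_goldenRatio]
  ring

lemma goldenConj_pow_eq (n : ℕ) : goldenConj ^ n = (-1) ^ n * goldenRatio⁻¹ ^ n := by
  rw [inv_goldenRatio, ← mul_pow]
  ring

lemma fib_mul_sqrt_five_mul (n : ℕ) :
    (Nat.fib n : ℝ) * √5 * goldenRatio⁻¹ ^ n = 1 - (-1) ^ n * (goldenRatio⁻¹ ^ n) ^ 2 := by
  have h : goldenRatio ^ n * goldenRatio⁻¹ ^ n = 1 := by
    rw [← mul_pow, mul_inv_cancel₀ goldenRatio_ne_zero, one_pow]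
  rw [coe_fib_eq, div_mul_cancel₀ _ (by positivity), goldenConj_pow_eq, sub_mul, h]
  ring

lemma tendsto_inv_goldenRatio_pow :
    Filter.Tendsto (fun n : ℕ => goldenRatio⁻¹ ^ (n + 1)) Filter.atTop (nhds 0) :=
  (tendsto_pow_atTop_nhds_zero_of_lt_one (inv_nonneg.2 goldenRatio_pos.le)
    (inv_lt_one_of_one_lt₀ one_lt_goldenRatio)).comp (Filter.tendsto_add_atTop_nat 1)

lemma tendsto_fib_succ_mul {c : ℝ} (hc : 0 < c) :
    Filter.Tendsto (fun n : ℕ => (Nat.fib (n + 1) : ℝ) * c) Filter.atTop Filter.atTop := by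
  refine Filter.Tendsto.atTop_mul_const hc (Filter.tendsto_atTop_mono (fun n => ?_)
    tendsto_natCast_atTop_atTop)
  have := Nat.le_fib_add_one (n + 1)
  exact_mod_cast (by lia : n ≤ Nat.fib (n + 1))

lemma exists_gt_mem_gapSetPlus {a b α : ℝ} (ha : 0 < a) (hb : 0 < b)
    (hab : a / b = goldenRatio) (hα : π ^ 2 / (√5 * a) < α) (M : ℝ) :
    ∃ k ∈ gapSetPlus a b α, M < k := by
  have hlim : Filter.Tendsto (fun n : ℕ => π ^ 2 / (√5 * a) *
      ((1 + (goldenRatio⁻¹ ^ (n + 1)) ^ 2) / (1 - (goldenRatio⁻¹ ^ (n + 1)) ^ 2)))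
      Filter.atTop (nhds (π ^ 2 / (√5 * a))) := by
    have hcont : ContinuousAt (fun x : ℝ => π ^ 2 / (√5 * a) * ((1 + x ^ 2) / (1 - x ^ 2))) 0 :=
      continuousAt_const.mul (ContinuousAt.div (by fun_prop) (by fun_prop) (by norm_num))
    simpa [Function.comp_def] using hcont.tendsto.comp tendsto_inv_goldenRatio_pow
  obtain ⟨N, hN⟩ := Filter.eventually_atTop.1 ((hlim.eventually_lt_const hα).and
    ((tendsto_inv_goldenRatio_pow.eventually_le_const (by norm_num : (0 : ℝ) < 1 / 3)).and
      ((tendsto_fib_succ_mul (div_pos pi_pos ha)).eventually_gt_atTop M)))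
  obtain ⟨h1, h2, h3⟩ := hN (2 * N) (by lia)
  have hodd : Odd (2 * N + 1) := ⟨N, rfl⟩
  have hF := fib_mul_sqrt_five_mul (2 * N + 1)
  have hq := fib_succ_div_goldenRatio (2 * N)
  rw [goldenConj_pow_eq] at hq
  rw [hodd.neg_one_pow] at hF hq
  have hδ : 0 < goldenRatio⁻¹ ^ (2 * N + 1) := pow_pos (inv_pos.2 goldenRatio_pos) _
  have hFpos : (0 : ℝ) < Nat.fib (2 * N + 1) := by exact_mod_cast Nat.fib_pos.2 (by lia)
  generalize goldenRatio⁻¹ ^ (2 * N + 1) = δ at *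
  generalize Nat.fib (2 * N + 1) = F at *
  generalize Nat.fib (2 * N) = G at *
  have hka : F * (π / a) * a = F * π := by field_simp
  have hkb : F * (π / a) * b = (G + δ) * π := by
    rw [show (G + δ : ℝ) = F / goldenRatio by rw [hq]; ring, ← hab]
    field_simp
  have hpi := pi_pos
  obtain ⟨k, hk, hlt⟩ := exists_mem_gapSetPlus (α := α) (k₀ := F * (π / a)) (p := F) (q := G)
    ha hb (by positivity) (by rw [hka]; field_simp; simp) (by rw [hka]; field_simp; simp)
    (by rw [hkb]; field_simp; push_cast; linarith)
    (by rw [hkb]; field_simp; push_cast; linarith) (by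
      rw [hka, hkb]
      push_cast
      rw [show F * π / 2 - π / 2 * F = 0 by ring,
        show (G + δ) * π / 2 - π / 2 * G = π / 2 * δ by ring, tan_zero, zero_add]
      refine lt_of_le_of_lt ?_ h1
      have hδ2 : 0 < 1 - δ ^ 2 := by nlinarith
      have htan := (lt_div_iff₀ hδ2).2 (tan_half_pi_mul_lt hδ h2)
      calc 2 * (F * (π / a)) * tan (π / 2 * δ)
          ≤ 2 * (F * (π / a)) * (π / 2 * δ / (1 - δ ^ 2)) := by gcongr
        _ = π ^ 2 / (√5 * a) * ((F * √5 * δ) / (1 - δ ^ 2)) := by field_simp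
        _ = _ := by rw [hF]; ring)
  exact ⟨k, hk, h3.trans hlt⟩

lemma exists_gt_mem_gapSetMinus {a b α : ℝ} (ha : 0 < a) (hb : 0 < b)
    (hab : a / b = goldenRatio) (hα : π ^ 2 / (√5 * a) ≤ |α|) (M : ℝ) :
    ∃ k ∈ gapSetMinus a b α, M < k := by
  obtain ⟨N, hN⟩ := Filter.eventually_atTop.1
    ((tendsto_inv_goldenRatio_pow.eventually_le_const (by norm_num : (0 : ℝ) < 1 / 3)).and
      ((tendsto_fib_succ_mul (div_pos pi_pos ha)).eventually_gt_atTop (M + 1)))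
  obtain ⟨h2, h3⟩ := hN (2 * N + 1) (by lia)
  have heven : Even (2 * N + 1 + 1) := ⟨N + 1, by ring⟩
  have hF := fib_mul_sqrt_five_mul (2 * N + 1 + 1)
  have hq := fib_succ_div_goldenRatio (2 * N + 1)
  rw [goldenConj_pow_eq] at hq
  rw [heven.neg_one_pow] at hF hq
  have hδ : 0 < goldenRatio⁻¹ ^ (2 * N + 1 + 1) := pow_pos (inv_pos.2 goldenRatio_pos) _
  have hFpos : (0 : ℝ) < Nat.fib (2 * N + 1 + 1) := by exact_mod_cast Nat.fib_pos.2 (by lia)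
  generalize goldenRatio⁻¹ ^ (2 * N + 1 + 1) = δ at *
  generalize Nat.fib (2 * N + 1 + 1) = F at *
  generalize Nat.fib (2 * N + 1) = G at *
  have hka : F * (π / a) * a = F * π := by field_simp
  have hkb : F * (π / a) * b = (G - δ) * π := by
    rw [show (G - δ : ℝ) = F / goldenRatio by rw [hq]; ring, ← hab]
    field_simp
  have hpi := pi_pos
  obtain ⟨k, hk, hlt⟩ := exists_mem_gapSetMinus (α := α) (k₀ := F * (π / a))
    (p := F - 1) (q := G - 1)
    ha hb (by positivity) (by rw [hka]; field_simp; simp) (by rw [hka]; field_simp; simp)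
    (by rw [hkb]; field_simp; push_cast; linarith)
    (by rw [hkb]; field_simp; push_cast; linarith) (by
      rw [hka, hkb]
      push_cast
      rw [show F * π / 2 - π / 2 * (F - 1) = π / 2 - 0 by ring,
        show (G - δ) * π / 2 - π / 2 * (G - 1) = π / 2 - π / 2 * δ by ring,
        cot_pi_div_two_sub, cot_pi_div_two_sub, tan_zero, zero_add]
      refine lt_of_lt_of_le ?_ hα
      have htan := tan_half_pi_mul_lt hδ h2
      have h5 : (0 : ℝ) < √5 := by positivity
      calc 2 * (F * (π / a)) * tan (π / 2 * δ)
          = 2 * π / (√5 * a * δ) * (tan (π / 2 * δ) * (F * √5 * δ)) := by field_simp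
        _ = 2 * π / (√5 * a * δ) * (tan (π / 2 * δ) * (1 - δ ^ 2)) := by rw [hF]; ring
        _ < 2 * π / (√5 * a * δ) * (π / 2 * δ) := by gcongr
        _ = π ^ 2 / (√5 * a) := by field_simp)
  exact ⟨k, hk, by linarith⟩

/-- For the golden-mean rectangular lattice (`a/b = (1+√5)/2`), if
`α > π²/(√5 a)` there are infinitely many spectral gaps, and likewise if
`α ≤ −π²/(√5 a)`. -/
theorem golden_mean_lattice_infinitely_many_gaps
    (a b α : ℝ) (ha : 0 < a) (hb : 0 < b) (hab : a / b = (1 + Real.sqrt 5) / 2) :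
    (α > π ^ 2 / (Real.sqrt 5 * a) → (gapComponents (gapSetPlus a b α)).Infinite) ∧
    (α ≤ -(π ^ 2 / (Real.sqrt 5 * a)) → (gapComponents (gapSetMinus a b α)).Infinite) := by
  have hab' : a / b = goldenRatio := hab
  refine ⟨fun hα => ?_, fun hα => ?_⟩
  · exact infinite_gapComponents_of_unbounded ha (fun k hk => hk.2.1)
      (exists_gt_mem_gapSetPlus ha hb hab' hα)
  · refine infinite_gapComponents_of_unbounded ha (fun k hk => hk.2.1)
      (exists_gt_mem_gapSetMinus ha hb hab' (le_abs.2 (Or.inr ?_)))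
    linarith
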